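/- Let f_1,…,f_m, N_1,…,N_m, s, c be a local model, let (x^{(1)},y^{(1)}),…,(x^{(n)},y^{(n)}) be a dataset with loss L, and let Θ : [0,∞) → ℝ^p be a gradient flow trajectory of L. Then for every t ≥ 0 and every x, x' ∈ ℝ^d, the time derivative of the tangent kernel along the trajectory satisfies |d/dt K_{Θ(t)}(x,x')| ≤ 4·√2·s⁴·c³·√(L(Θ(0)) / m). -/

import Mathlib

open Real MeasureTheory ProbabilityTheory

/-- Partial derivative of `g : ℝ^p → ℝ` with respect to the `j`-th coordinate. -/
noncomputable def pder {p : ℕ} (j : Fin p) (g : (Fin p → ℝ) → ℝ) (Θ : Fin p → ℝ) : ℝ :=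
  fderiv ℝ g Θ (Pi.single j 1)

/-- The model function `f(Θ,x) = m^{-1/2} ∑_k f_k(Θ,x)`. -/
noncomputable def modelF {m p d : ℕ} (f : Fin m → (Fin p → ℝ) → (Fin d → ℝ) → ℝ)
    (Θ : Fin p → ℝ) (x : Fin d → ℝ) : ℝ :=
  (Real.sqrt m)⁻¹ * ∑ k, f k Θ x

/-- The tangent kernel `K_Θ(x,x') = ∑_j ∂_{θ_j} f(Θ,x) ⬝ ∂_{θ_j} f(Θ,x')`. -/
noncomputable def kernelK {m p d : ℕ} (f : Fin m → (Fin p → ℝ) → (Fin d → ℝ) → ℝ)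
    (Θ : Fin p → ℝ) (x x' : Fin d → ℝ) : ℝ :=
  ∑ j : Fin p, pder j (fun Θ' => modelF f Θ' x) Θ * pder j (fun Θ' => modelF f Θ' x') Θ

/-- A local model: each `f_k` is C², depends only on the parameters in `N k`,
`|N k| ≤ s`, each parameter appears in at most `s` of the `N k`'s, and all first and
second partial derivatives of the `f_k` are bounded by `c`. -/
def IsLocalModel {m p d : ℕ} (f : Fin m → (Fin p → ℝ) → (Fin d → ℝ) → ℝ)
    (N : Fin m → Finset (Fin p)) (s c : ℝ) : Prop :=
  (∀ k x, ContDiff ℝ 2 fun Θ => f k Θ x) ∧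
  (∀ k x (Θ Θ' : Fin p → ℝ), (∀ j ∈ N k, Θ j = Θ' j) → f k Θ x = f k Θ' x) ∧
  (∀ k, ((N k).card : ℝ) ≤ s) ∧
  (∀ j : Fin p, ((Finset.univ.filter fun k => j ∈ N k).card : ℝ) ≤ s) ∧
  (∀ k j Θ x, |pder j (fun Θ' => f k Θ' x) Θ| ≤ c) ∧
  (∀ k i j Θ x, |pder i (fun Θ' => pder j (fun Θ'' => f k Θ'' x) Θ') Θ| ≤ c)

/-- The mean squared error loss `L(Θ) = (1/n) ∑_i ½(f(Θ,x⁽ⁱ⁾) − y⁽ⁱ⁾)²`. -/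
noncomputable def lossL {m p d n : ℕ} (f : Fin m → (Fin p → ℝ) → (Fin d → ℝ) → ℝ)
    (X : Fin n → Fin d → ℝ) (Y : Fin n → ℝ) (Θ : Fin p → ℝ) : ℝ :=
  (n : ℝ)⁻¹ * ∑ i, (1 / 2) * (modelF f Θ (X i) - Y i) ^ 2

theorem fderiv_apply_eq_sum_pder {p : ℕ} (g : (Fin p → ℝ) → ℝ) (Θ v : Fin p → ℝ) :
    fderiv ℝ g Θ v = ∑ i, v i * pder i g Θ := by
  conv_lhs => rw [pi_eq_sum_univ' v]
  simp only [map_sum, map_smul, smul_eq_mul, pder]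

theorem hasDerivAt_comp_curve {p : ℕ} {h : (Fin p → ℝ) → ℝ} (hh : Differentiable ℝ h)
    {Θ : ℝ → Fin p → ℝ} {v : Fin p → ℝ} {t : ℝ} (hΘ : ∀ j, HasDerivAt (fun u => Θ u j) (v j) t) :
    HasDerivAt (fun u => h (Θ u)) (∑ i, v i * pder i h (Θ t)) t := by
  rw [← fderiv_apply_eq_sum_pder]
  exact (hh (Θ t)).hasFDerivAt.comp_hasDerivAt t (hasDerivAt_pi.2 hΘ)

theorem differentiable_pder {p : ℕ} {g : (Fin p → ℝ) → ℝ} (hg : ContDiff ℝ 2 g) (j : Fin p) :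
    Differentiable ℝ (pder j g) := by
  have h : Differentiable ℝ (fderiv ℝ g) :=
    (hg.fderiv_right (m := 1) (by norm_num)).differentiable (by norm_num)
  exact fun Θ => (h Θ).clm_apply (differentiableAt_const _)

theorem pder_eq_zero_of_notMem {p : ℕ} {g : (Fin p → ℝ) → ℝ} {S : Finset (Fin p)}
    (hg : ∀ Θ Θ' : Fin p → ℝ, (∀ j ∈ S, Θ j = Θ' j) → g Θ = g Θ') (hd : Differentiable ℝ g)
    {j : Fin p} (hj : j ∉ S) (Θ : Fin p → ℝ) : pder j g Θ = 0 := by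
  rw [pder, ← (hd Θ).lineDeriv_eq_fderiv, lineDeriv]
  have : (fun t : ℝ => g (Θ + t • Pi.single j 1)) = fun _ => g Θ := by
    funext t
    refine hg _ _ fun i hi => ?_
    have : i ≠ j := fun h => hj (h ▸ hi)
    simp [this]
  rw [this, deriv_const]

theorem pder_congr_of_eqOn {p : ℕ} {g : (Fin p → ℝ) → ℝ} {S : Finset (Fin p)}
    (hg : ∀ Θ Θ' : Fin p → ℝ, (∀ j ∈ S, Θ j = Θ' j) → g Θ = g Θ')
    (j : Fin p) (Θ Θ' : Fin p → ℝ) (h : ∀ i ∈ S, Θ i = Θ' i) : pder j g Θ = pder j g Θ' := by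
  have : g = fun y => g (y + (Θ' - Θ)) := by
    funext y
    refine hg _ _ fun i hi => ?_
    simp [h i hi]
  rw [pder, pder]
  conv_lhs => rw [this, fderiv_comp_add_right]
  simp

theorem pder_modelF {m p d : ℕ} {f : Fin m → (Fin p → ℝ) → (Fin d → ℝ) → ℝ}
    (x : Fin d → ℝ) (hf : ∀ k, Differentiable ℝ fun Θ => f k Θ x) (j : Fin p) (Θ : Fin p → ℝ) :
    pder j (fun Θ' => modelF f Θ' x) Θ =
      (Real.sqrt m)⁻¹ * ∑ k, pder j (fun Θ' => f k Θ' x) Θ := by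
  simp only [pder, modelF]
  rw [fderiv_const_mul (DifferentiableAt.fun_sum fun k _ => hf k Θ),
    fderiv_fun_sum fun k _ => hf k Θ]
  simp

theorem pder_pder_modelF {m p d : ℕ} {f : Fin m → (Fin p → ℝ) → (Fin d → ℝ) → ℝ}
    (x : Fin d → ℝ) (hf : ∀ k, ContDiff ℝ 2 fun Θ => f k Θ x) (i j : Fin p) (Θ : Fin p → ℝ) :
    pder i (pder j fun Θ' => modelF f Θ' x) Θ =
      (Real.sqrt m)⁻¹ * ∑ k, pder i (fun Θ' => pder j (fun Θ'' => f k Θ'' x) Θ') Θ := by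
  have h : (pder j fun Θ' => modelF f Θ' x) =
      fun Θ => (Real.sqrt m)⁻¹ * ∑ k, pder j (fun Θ' => f k Θ' x) Θ :=
    funext fun Θ => pder_modelF x (fun k => (hf k).differentiable (by norm_num)) j Θ
  rw [h]
  exact pder_modelF (f := fun k Θ (x : Fin d → ℝ) => pder j (fun Θ' => f k Θ' x) Θ) x
    (fun k => differentiable_pder (hf k) j) i Θ

theorem contDiff_modelF {m p d : ℕ} {f : Fin m → (Fin p → ℝ) → (Fin d → ℝ) → ℝ}
    (x : Fin d → ℝ) (hf : ∀ k, ContDiff ℝ 2 fun Θ => f k Θ x) :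
    ContDiff ℝ 2 fun Θ => modelF f Θ x := by
  unfold modelF
  exact contDiff_const.mul (ContDiff.sum fun k _ => hf k)

theorem differentiable_lossL {m p d n : ℕ} {f : Fin m → (Fin p → ℝ) → (Fin d → ℝ) → ℝ}
    (X : Fin n → Fin d → ℝ) (Y : Fin n → ℝ)
    (hf : ∀ x, Differentiable ℝ fun Θ => modelF f Θ x) : Differentiable ℝ (lossL f X Y) := by
  unfold lossL
  have := fun a => hf (X a)
  fun_prop

theorem pder_lossL {m p d n : ℕ} {f : Fin m → (Fin p → ℝ) → (Fin d → ℝ) → ℝ}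
    (X : Fin n → Fin d → ℝ) (Y : Fin n → ℝ)
    (hf : ∀ x, Differentiable ℝ fun Θ => modelF f Θ x) (i : Fin p) (Θ : Fin p → ℝ) :
    pder i (lossL f X Y) Θ = (n : ℝ)⁻¹ * ∑ a, (modelF f Θ (X a) - Y a) *
      pder i (fun Θ' => modelF f Θ' (X a)) Θ := by
  have h : HasFDerivAt (lossL f X Y) ((n : ℝ)⁻¹ • ∑ a, (modelF f Θ (X a) - Y a) •
      fderiv ℝ (fun Θ' => modelF f Θ' (X a)) Θ) Θ := by
    unfold lossL
    refine HasFDerivAt.const_mul (HasFDerivAt.fun_sum fun a _ => ?_) _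
    have := ((((hf (X a)) Θ).hasFDerivAt.sub_const (Y a)).pow 2).const_mul (1 / 2)
    refine this.congr_fderiv ?_
    ext v
    simp
    ring
  rw [pder, h.fderiv]
  simp [pder]

theorem lossL_nonneg {m p d n : ℕ} (f : Fin m → (Fin p → ℝ) → (Fin d → ℝ) → ℝ)
    (X : Fin n → Fin d → ℝ) (Y : Fin n → ℝ) (Θ : Fin p → ℝ) : 0 ≤ lossL f X Y Θ := by
  unfold lossL
  positivity

theorem mean_abs_residual_le {m p d n : ℕ} (f : Fin m → (Fin p → ℝ) → (Fin d → ℝ) → ℝ)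
    (X : Fin n → Fin d → ℝ) (Y : Fin n → ℝ) (Θ : Fin p → ℝ) :
    (n : ℝ)⁻¹ * ∑ a, |modelF f Θ (X a) - Y a| ≤ Real.sqrt (2 * lossL f X Y Θ) := by
  apply Real.le_sqrt_of_sq_le
  have h := sq_sum_le_card_mul_sum_sq (s := Finset.univ)
    (f := fun a => |modelF f Θ (X a) - Y a|)
  simp only [sq_abs, Finset.card_univ, Fintype.card_fin] at h
  unfold lossL
  rw [← Finset.mul_sum]
  rcases Nat.eq_zero_or_pos n with hn | hn
  · subst hn; simp
  have hn' : (0 : ℝ) < n := by exact_mod_cast hn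
  rw [mul_pow]
  calc _ ≤ ((n : ℝ)⁻¹) ^ 2 * (n * ∑ a, (modelF f Θ (X a) - Y a) ^ 2) := by gcongr
    _ = _ := by field_simp

namespace IsLocalModel

variable {m p d : ℕ} {f : Fin m → (Fin p → ℝ) → (Fin d → ℝ) → ℝ} {N : Fin m → Finset (Fin p)}
  {s c : ℝ}

theorem abs_pder_modelF_le (h : IsLocalModel f N s c) (hc : 0 ≤ c) (x : Fin d → ℝ) (j : Fin p)
    (Θ : Fin p → ℝ) : |pder j (fun Θ' => modelF f Θ' x) Θ| ≤ (Real.sqrt m)⁻¹ * (s * c) := by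
  obtain ⟨hf, hN, -, hdeg, h1, -⟩ := h
  have hd := fun k => (hf k x).differentiable (by norm_num)
  rw [pder_modelF x hd, abs_mul, abs_of_nonneg (by positivity : 0 ≤ (Real.sqrt m)⁻¹)]
  gcongr
  calc |∑ k, pder j (fun Θ' => f k Θ' x) Θ|
      ≤ ∑ k, |pder j (fun Θ' => f k Θ' x) Θ| := Finset.abs_sum_le_sum_abs _ _
    _ ≤ ∑ k, if j ∈ N k then c else 0 := by
        refine Finset.sum_le_sum fun k _ => ?_
        split_ifs with hj
        · exact h1 k j Θ x
        · rw [pder_eq_zero_of_notMem (hN k x) (hd k) hj, abs_zero]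
    _ = ((Finset.univ.filter fun k => j ∈ N k).card : ℝ) * c := by
        rw [← Finset.sum_filter, Finset.sum_const, nsmul_eq_mul]
    _ ≤ s * c := by gcongr; exact hdeg j

theorem sum_abs_pder_pder_modelF_le (h : IsLocalModel f N s c) (hc : 0 ≤ c)
    (x : Fin d → ℝ) (Θ : Fin p → ℝ) :
    ∑ j, ∑ i, |pder i (pder j fun Θ' => modelF f Θ' x) Θ| ≤ Real.sqrt m * (s ^ 2 * c) := by
  obtain ⟨hf, hN, hcard, -, -, h2⟩ := h
  have hd := fun k => (hf k x).differentiable (by norm_num)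
  have hbound : ∀ k i j, |pder i (fun Θ' => pder j (fun Θ'' => f k Θ'' x) Θ') Θ| ≤
      if j ∈ N k then if i ∈ N k then c else 0 else 0 := by
    intro k i j
    split_ifs with hj hi
    · exact h2 k i j Θ x
    · rw [pder_eq_zero_of_notMem (pder_congr_of_eqOn (hN k x) j)
        (differentiable_pder (hf k x) j) hi, abs_zero]
    · have : (fun Θ' => pder j (fun Θ'' => f k Θ'' x) Θ') = fun _ => 0 :=
        funext fun Θ' => pder_eq_zero_of_notMem (hN k x) (hd k) hj Θ'
      rw [this]
      simp [pder]
  calc ∑ j, ∑ i, |pder i (pder j fun Θ' => modelF f Θ' x) Θ|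
      ≤ ∑ j, ∑ i, ∑ k, (Real.sqrt m)⁻¹ *
          (if j ∈ N k then if i ∈ N k then c else 0 else 0) := by
        refine Finset.sum_le_sum fun j _ => Finset.sum_le_sum fun i _ => ?_
        rw [pder_pder_modelF x (fun k => hf k x), abs_mul,
          abs_of_nonneg (by positivity : 0 ≤ (Real.sqrt m)⁻¹), ← Finset.mul_sum]
        gcongr
        exact (Finset.abs_sum_le_sum_abs _ _).trans (Finset.sum_le_sum fun k _ => hbound k i j)
    _ = ∑ k, (Real.sqrt m)⁻¹ * (((N k).card : ℝ) ^ 2 * c) := by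
        simp_rw [← Finset.mul_sum]
        congr 1
        rw [Finset.sum_congr rfl fun j _ => Finset.sum_comm, Finset.sum_comm]
        refine Finset.sum_congr rfl fun k _ => ?_
        simp only [Finset.sum_ite_irrel, Finset.sum_const_zero, Finset.sum_ite_mem,
          Finset.univ_inter, Finset.sum_const, nsmul_eq_mul]
        ring
    _ ≤ ∑ k : Fin m, (Real.sqrt m)⁻¹ * (s ^ 2 * c) := by
        gcongr with k
        exact hcard k
    _ = Real.sqrt m * (s ^ 2 * c) := by
        rw [Finset.sum_const, Finset.card_univ, Fintype.card_fin, nsmul_eq_mul, ← mul_assoc,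
          ← div_eq_mul_inv, Real.div_sqrt]

theorem differentiable_modelF (h : IsLocalModel f N s c) (x : Fin d → ℝ) :
    Differentiable ℝ fun Θ => modelF f Θ x :=
  (contDiff_modelF x fun k => h.1 k x).differentiable (by norm_num)

theorem abs_pder_lossL_le (h : IsLocalModel f N s c) (hc : 0 ≤ c) {n : ℕ}
    (X : Fin n → Fin d → ℝ) (Y : Fin n → ℝ) (i : Fin p) (Θ : Fin p → ℝ) :
    |pder i (lossL f X Y) Θ| ≤
      Real.sqrt (2 * lossL f X Y Θ) * ((Real.sqrt m)⁻¹ * (s * c)) := by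
  have hB : 0 ≤ (Real.sqrt m)⁻¹ * (s * c) :=
    (abs_nonneg _).trans (h.abs_pder_modelF_le hc 0 i Θ)
  rw [pder_lossL X Y h.differentiable_modelF, abs_mul,
    abs_of_nonneg (by positivity : 0 ≤ (n : ℝ)⁻¹)]
  calc _ ≤ (n : ℝ)⁻¹ * ∑ a, |modelF f Θ (X a) - Y a| * ((Real.sqrt m)⁻¹ * (s * c)) := by
        gcongr
        refine (Finset.abs_sum_le_sum_abs _ _).trans (Finset.sum_le_sum fun a _ => ?_)
        rw [abs_mul]
        gcongr
        exact h.abs_pder_modelF_le hc (X a) i Θ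
    _ = ((n : ℝ)⁻¹ * ∑ a, |modelF f Θ (X a) - Y a|) * ((Real.sqrt m)⁻¹ * (s * c)) := by
        rw [← Finset.sum_mul, mul_assoc]
    _ ≤ _ := by
        gcongr
        exact mean_abs_residual_le f X Y Θ

end IsLocalModel

theorem gradient_flow_le_initial {p : ℕ} {L : (Fin p → ℝ) → ℝ} (hL : Differentiable ℝ L)
    {Θ : ℝ → Fin p → ℝ} (hflow : ∀ t : ℝ, 0 ≤ t → ∀ j : Fin p,
      HasDerivAt (fun u => Θ u j) (-(pder j L (Θ t))) t) {t : ℝ} (ht : 0 ≤ t) :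
    L (Θ t) ≤ L (Θ 0) := by
  have hd := fun u (hu : 0 ≤ u) => hasDerivAt_comp_curve hL (hflow u hu)
  have hanti : AntitoneOn (fun u => L (Θ u)) (Set.Ici 0) := by
    refine antitoneOn_of_deriv_nonpos (convex_Ici 0)
      (fun u hu => (hd u hu).continuousAt.continuousWithinAt)
      (fun u hu => (hd u (interior_subset hu)).differentiableAt.differentiableWithinAt)
      fun u hu => ?_
    rw [(hd u (interior_subset hu)).deriv]
    refine Finset.sum_nonpos fun i _ => ?_
    nlinarith [sq_nonneg (pder i L (Θ u))]
  exact hanti Set.self_mem_Ici ht ht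

theorem abs_sum_sum_mul_mul_le {p : ℕ} {H : Fin p → Fin p → ℝ} {v g : Fin p → ℝ} {V B S : ℝ}
    (hV : 0 ≤ V) (hB : 0 ≤ B) (hv : ∀ i, |v i| ≤ V) (hg : ∀ j, |g j| ≤ B)
    (hH : ∑ j, ∑ i, |H i j| ≤ S) : |∑ j, (∑ i, v i * H i j) * g j| ≤ S * (V * B) := by
  calc |∑ j, (∑ i, v i * H i j) * g j|
      ≤ ∑ j, (∑ i, |H i j|) * (V * B) := by
        refine (Finset.abs_sum_le_sum_abs _ _).trans (Finset.sum_le_sum fun j _ => ?_)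
        rw [abs_mul, ← mul_assoc]
        refine mul_le_mul ?_ (hg j) (abs_nonneg _) (by positivity)
        rw [Finset.sum_mul]
        refine (Finset.abs_sum_le_sum_abs _ _).trans (Finset.sum_le_sum fun i _ => ?_)
        rw [abs_mul, mul_comm]
        gcongr
        exact hv i
    _ ≤ S * (V * B) := by
        rw [← Finset.sum_mul]
        gcongr

/-- Along a gradient flow trajectory of the loss of a local model, the tangent kernel
changes with speed at most `4√2·s⁴·c³·√(L(Θ(0))/m)`. -/
theorem gradient_flow_kernel_speed_bound
    {m p d n : ℕ} (hm : 1 ≤ m) (hp : 1 ≤ p) (hd : 1 ≤ d) {s c : ℝ} (hs : 1 ≤ s) (hc : 0 < c)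
    (f : Fin m → (Fin p → ℝ) → (Fin d → ℝ) → ℝ) (N : Fin m → Finset (Fin p))
    (hloc : IsLocalModel f N s c)
    (X : Fin n → Fin d → ℝ) (Y : Fin n → ℝ)
    (Θ : ℝ → Fin p → ℝ)
    (hflow : ∀ t : ℝ, 0 ≤ t → ∀ j : Fin p,
      HasDerivAt (fun u => Θ u j) (-(pder j (lossL f X Y) (Θ t))) t) :
    ∀ t : ℝ, 0 ≤ t → ∀ x x' : Fin d → ℝ,
      |deriv (fun u => kernelK f (Θ u) x x') t| ≤
        4 * Real.sqrt 2 * s ^ 4 * c ^ 3 * Real.sqrt (lossL f X Y (Θ 0) / m) := by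
  intro t ht x x'
  set B : ℝ := (Real.sqrt m)⁻¹ * (s * c) with hB
  set V : ℝ := Real.sqrt (2 * lossL f X Y (Θ 0)) * B with hV
  have hB0 : 0 ≤ B := by positivity
  have hV0 : 0 ≤ V := by positivity
  have hv : ∀ i, |-(pder i (lossL f X Y) (Θ t))| ≤ V := by
    intro i
    rw [abs_neg]
    refine (hloc.abs_pder_lossL_le hc.le X Y i (Θ t)).trans ?_
    rw [hV]
    gcongr
    exact gradient_flow_le_initial (differentiable_lossL X Y hloc.differentiable_modelF) hflow ht
  have hpder : ∀ z j, HasDerivAt (fun u => pder j (fun Θ' => modelF f Θ' z) (Θ u))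
      (∑ i, -(pder i (lossL f X Y) (Θ t)) * pder i (pder j fun Θ' => modelF f Θ' z) (Θ t)) t :=
    fun z j => hasDerivAt_comp_curve
      (differentiable_pder (contDiff_modelF z fun k => hloc.1 k z) j) (hflow t ht)
  have hK : HasDerivAt (fun u => kernelK f (Θ u) x x') _ t :=
    HasDerivAt.fun_sum fun j _ => (hpder x j).fun_mul (hpder x' j)
  have key : ∀ z z', |∑ j, (∑ i, -(pder i (lossL f X Y) (Θ t)) *
      pder i (pder j fun Θ' => modelF f Θ' z) (Θ t)) *
        pder j (fun Θ' => modelF f Θ' z') (Θ t)| ≤ Real.sqrt m * (s ^ 2 * c) * (V * B) :=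
    fun z z' => abs_sum_sum_mul_mul_le
      (H := fun i j => pder i (pder j fun Θ' => modelF f Θ' z) (Θ t)) hV0 hB0 hv
      (fun j => hloc.abs_pder_modelF_le hc.le z' j (Θ t))
      (hloc.sum_abs_pder_pder_modelF_le hc.le z (Θ t))
  have hm0 : 0 < Real.sqrt m := Real.sqrt_pos.2 (by exact_mod_cast hm)
  have hval : Real.sqrt m * (s ^ 2 * c) * (V * B) =
      Real.sqrt 2 * s ^ 4 * c ^ 3 * Real.sqrt (lossL f X Y (Θ 0) / m) := by
    rw [hV, hB, Real.sqrt_div (lossL_nonneg f X Y _), Real.sqrt_mul zero_le_two]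
    field_simp
  have hnn : 0 ≤ Real.sqrt 2 * s ^ 4 * c ^ 3 * Real.sqrt (lossL f X Y (Θ 0) / m) := by
    positivity
  rw [hK.deriv, Finset.sum_add_distrib]
  refine (abs_add_le _ _).trans ?_
  have h1 := key x x'
  have h2 := key x' x
  simp only [mul_comm (∑ i, _) (pder _ _ _)] at h1 h2 ⊢
  linarith
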